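/- Let G be a simple graph on a finite vertex type V with n = |V| vertices, and let e₁, e₂, …, e_p be distinct edges of G. For 0 ≤ j ≤ p let G_j be the graph obtained from G by deleting the edges e₁, …, e_j. Then the set of all subsets S of V that arise as the vertex set of a connected component of G_j for some 0 ≤ j ≤ p has cardinality at most n + p. -/

import Mathlib

theorem supp_eq_of_step {V : Type*} (G H : SimpleGraph V) (hle : H ≤ G) (a b v : V)
    (hadj : ∀ x y, G.Adj x y → s(x, y) ≠ s(a, b) → H.Adj x y)
    (hv : ¬ G.Reachable v a) :
    (G.connectedComponentMk v).supp = (H.connectedComponentMk v).supp := by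
  have key : ∀ w, G.Reachable v w → H.Reachable v w := by
    intro w hw
    rw [SimpleGraph.reachable_iff_reflTransGen] at hw
    induction hw with
    | refl => exact SimpleGraph.Reachable.refl _
    | @tail x y hx hxy ih =>
      have hvx : G.Reachable v x := (SimpleGraph.reachable_iff_reflTransGen _ _).2 hx
      refine ih.trans (hadj x y hxy ?_).reachable
      intro h
      rcases Sym2.eq_iff.1 h with ⟨h1, _⟩ | ⟨_, h2⟩
      · exact hv (h1 ▸ hvx)
      · exact hv (h2 ▸ hvx.trans hxy.reachable)
  ext w
  simp only [SimpleGraph.ConnectedComponent.mem_supp_iff, SimpleGraph.ConnectedComponent.eq]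
  exact ⟨fun h => (key w h.symm).symm, fun h => h.mono hle⟩

/-- Deleting `p` distinct edges one at a time from a simple graph on `n`
vertices produces, over all intermediate graphs, at most `n + p` distinct
vertex sets of connected components. -/
theorem component_supports_bound {V : Type*} [Fintype V] (G : SimpleGraph V)
    (p : ℕ) (ed : Fin p → Sym2 V) (hinj : Function.Injective ed)
    (hmem : ∀ i, ed i ∈ G.edgeSet) :
    Set.ncard {s : Set V | ∃ j ≤ p,
        ∃ c : (G.deleteEdges (ed '' {i : Fin p | (i : ℕ) < j})).ConnectedComponent,
          s = c.supp}
      ≤ Fintype.card V + p := by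
  classical
  let H : ℕ → SimpleGraph V := fun j => G.deleteEdges (ed '' {i : Fin p | (i : ℕ) < j})
  let f : V ⊕ Fin p → Set V := Sum.elim (fun v => ((H p).connectedComponentMk v).supp)
    (fun i => ((H i).connectedComponentMk (ed i).out.1).supp)
  have main : ∀ d j, j + d = p → ∀ v, ((H j).connectedComponentMk v).supp ∈ Set.range f := by
    intro d
    induction d with
    | zero =>
      intro j hj v
      obtain rfl : j = p := by omega
      exact ⟨Sum.inl v, rfl⟩
    | succ d ih =>
      intro j hj v
      have hjp : j < p := by omega
      by_cases hv : (H j).Reachable v (ed ⟨j, hjp⟩).out.1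
      · refine ⟨Sum.inr ⟨j, hjp⟩, ?_⟩
        change ((H j).connectedComponentMk _).supp = _
        rw [SimpleGraph.ConnectedComponent.sound hv]
      · rw [supp_eq_of_step (H j) (H (j + 1)) ?_ _ (ed ⟨j, hjp⟩).out.2 v ?_ hv]
        · exact ih (j + 1) (by omega) v
        · refine SimpleGraph.deleteEdges_anti (Set.image_mono ?_)
          intro i hi
          simp only [Set.mem_setOf_eq] at hi ⊢
          omega
        · intro x y hxy hne
          have he : s((ed ⟨j, hjp⟩).out.1, (ed ⟨j, hjp⟩).out.2) = ed ⟨j, hjp⟩ := Quot.out_eq _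
          rw [he] at hne
          simp only [H, SimpleGraph.deleteEdges_adj] at hxy ⊢
          refine ⟨hxy.1, ?_⟩
          rintro ⟨i, hi, hie⟩
          simp only [Set.mem_setOf_eq] at hi
          rcases Nat.lt_or_ge i j with h | h
          · exact hxy.2 ⟨i, h, hie⟩
          · have : i = ⟨j, hjp⟩ := Fin.ext (by simp; omega)
            exact hne (this ▸ hie.symm)
  have hsub : {s : Set V | ∃ j ≤ p,
        ∃ c : (G.deleteEdges (ed '' {i : Fin p | (i : ℕ) < j})).ConnectedComponent,
          s = c.supp} ⊆ Set.range f := by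
    rintro s ⟨j, hj, c, rfl⟩
    induction c using SimpleGraph.ConnectedComponent.ind with
    | _ v => exact main (p - j) j (by omega) v
  refine (Set.ncard_le_ncard hsub (Set.finite_range f)).trans ?_
  rw [← Set.image_univ]
  refine (Set.ncard_image_le Set.finite_univ).trans ?_
  simp [Set.ncard_univ]
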